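/- Let n ≥ 3, ν > n/2 − 1, 1 ≤ p ≤ 2 and q_{ν,p} ≤ q < ∞. Then there is no constant C > 0 such that ‖T_ν F‖_{L^{p,q}_ν} ≤ C·‖F‖_{L^{p,q}_ν} holds for all F ∈ L²_ν with ‖F‖_{L^{p,q}_ν} < ∞; that is, the weighted Bergman projection admits no bounded extension to L^{p,q}_ν. -/

import Mathlib

open MeasureTheory Complex Set
open scoped ENNReal NNReal

noncomputable section

def lorentzQ (n : ℕ) [NeZero n] (y : Fin n → ℝ) : ℝ :=
  y 0 ^ 2 - ∑ k ∈ Finset.univ.filter (fun k => k ≠ 0), y k ^ 2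

def lorentzQC (n : ℕ) [NeZero n] (z : Fin n → ℂ) : ℂ :=
  z 0 ^ 2 - ∑ k ∈ Finset.univ.filter (fun k => k ≠ 0), z k ^ 2

def lightCone (n : ℕ) [NeZero n] : Set (Fin n → ℝ) :=
  {y | 0 < y 0 ∧ 0 < lorentzQ n y}

def tubePt (n : ℕ) (x y : Fin n → ℝ) : Fin n → ℂ :=
  fun k => (x k : ℂ) + (y k : ℂ) * Complex.I

def inTube (n : ℕ) [NeZero n] (z : Fin n → ℂ) : Prop :=
  (fun k => (z k).im) ∈ lightCone n

def eVec (n : ℕ) [NeZero n] : Fin n → ℝ := fun k => if k = 0 then 1 else 0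

def mixedNorm (n : ℕ) [NeZero n] (p q ν : ℝ) (F : (Fin n → ℂ) → ℂ) : ℝ≥0∞ :=
  (∫⁻ y in lightCone n,
      (∫⁻ x : Fin n → ℝ, (‖F (tubePt n x y)‖₊ : ℝ≥0∞) ^ p) ^ (q / p)
        * ENNReal.ofReal (lorentzQ n y ^ (ν - (n : ℝ) / 2))) ^ (1 / q)

def bergmanIntegrand (n : ℕ) [NeZero n] (ν : ℝ) (F : (Fin n → ℂ) → ℂ) (z : Fin n → ℂ)
    (uv : (Fin n → ℝ) × (Fin n → ℝ)) : ℂ :=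
  lorentzQC n (fun k => (z k - ((uv.1 k : ℂ) - (uv.2 k : ℂ) * Complex.I)) / Complex.I)
      ^ (((-(ν + (n : ℝ) / 2) : ℝ)) : ℂ)
    * F (tubePt n uv.1 uv.2)
    * ((lorentzQ n uv.2 ^ (ν - (n : ℝ) / 2) : ℝ) : ℂ)

def bergmanOp (n : ℕ) [NeZero n] (ν : ℝ) (F : (Fin n → ℂ) → ℂ) (z : Fin n → ℂ) : ℂ :=
  ∫ uv in (univ ×ˢ lightCone n : Set ((Fin n → ℝ) × (Fin n → ℝ))),
    bergmanIntegrand n ν F z uv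

def qnu (n : ℕ) (ν : ℝ) : ℝ := (ν + (n : ℝ) / 2 - 1) / ((n : ℝ) / 2 - 1)

def pSharp (p : ℝ) : ℝ := if p ≤ 2 then p else p / (p - 1)

def qtilde (n : ℕ) (ν p : ℝ) : ℝ≥0∞ :=
  if 1 < (n : ℝ) / 2 * (1 - 1 / p) then
    ENNReal.ofReal ((ν + (n : ℝ) / 2 - 1) / ((n : ℝ) / 2 * (1 - 1 / p) - 1))
  else ∞

open Filter Topology

variable {d : ℕ}

lemma lorentzQ_eq (y : Fin (d + 2) → ℝ) :
    lorentzQ (d + 2) y = (y 0 + y 1) * (y 0 - y 1) - ∑ i : Fin d, y i.succ.succ ^ 2 := by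
  unfold lorentzQ
  rw [Finset.sum_filter, Fin.sum_univ_succ, Fin.sum_univ_succ]
  simp [Fin.succ_ne_zero]
  ring

/-- A Lorentz similarity of ratio `r` fixing the light ray `y₀ = y₁, y₂ = ⋯ = 0`; it is a dilation
followed by a null rotation with parameter `c`. -/
def nullSim (r : ℝ) (c : Fin d → ℝ) : (Fin (d + 2) → ℝ) →ₗ[ℝ] (Fin (d + 2) → ℝ) where
  toFun y :=
    Fin.cons
      (((y 0 - y 1 - 2 * ∑ i, c i * y i.succ.succ + (∑ i, c i ^ 2) * (y 0 + y 1))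
        + r ^ 2 * (y 0 + y 1)) / 2)
      (Fin.cons
        ((r ^ 2 * (y 0 + y 1)
          - (y 0 - y 1 - 2 * ∑ i, c i * y i.succ.succ + (∑ i, c i ^ 2) * (y 0 + y 1))) / 2)
        (fun i => r * (y i.succ.succ - (y 0 + y 1) * c i)))
  map_add' x y := by
    ext k
    refine Fin.cases ?_ (fun k => Fin.cases ?_ (fun i => ?_) k) k <;>
      simp [mul_add, Finset.sum_add_distrib] <;> ring
  map_smul' a y := by
    ext k
    refine Fin.cases ?_ (fun k => Fin.cases ?_ (fun i => ?_) k) k <;>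
      simp [mul_left_comm _ a, ← Finset.mul_sum] <;> ring

lemma nullSim_zero (r : ℝ) (c : Fin d → ℝ) (y : Fin (d + 2) → ℝ) :
    nullSim r c y 0 =
      ((y 0 - y 1 - 2 * ∑ i, c i * y i.succ.succ + (∑ i, c i ^ 2) * (y 0 + y 1))
        + r ^ 2 * (y 0 + y 1)) / 2 := rfl

lemma nullSim_one (r : ℝ) (c : Fin d → ℝ) (y : Fin (d + 2) → ℝ) :
    nullSim r c y 1 =
      (r ^ 2 * (y 0 + y 1)
        - (y 0 - y 1 - 2 * ∑ i, c i * y i.succ.succ + (∑ i, c i ^ 2) * (y 0 + y 1))) / 2 := rfl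

lemma nullSim_succ_succ (r : ℝ) (c : Fin d → ℝ) (y : Fin (d + 2) → ℝ) (i : Fin d) :
    nullSim r c y i.succ.succ = r * (y i.succ.succ - (y 0 + y 1) * c i) := rfl

lemma nullSim_zero_add_one (r : ℝ) (c : Fin d → ℝ) (y : Fin (d + 2) → ℝ) :
    nullSim r c y 0 + nullSim r c y 1 = r ^ 2 * (y 0 + y 1) := by
  rw [nullSim_zero, nullSim_one]; ring

lemma lorentzQ_nullSim (r : ℝ) (c : Fin d → ℝ) (y : Fin (d + 2) → ℝ) :
    lorentzQ (d + 2) (nullSim r c y) = r ^ 2 * lorentzQ (d + 2) y := by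
  rw [lorentzQ_eq, lorentzQ_eq, nullSim_zero_add_one]
  have h : ∑ i : Fin d, nullSim r c y i.succ.succ ^ 2 =
      r ^ 2 * (∑ i : Fin d, y i.succ.succ ^ 2 - 2 * (y 0 + y 1) * ∑ i, c i * y i.succ.succ
        + (y 0 + y 1) ^ 2 * ∑ i, c i ^ 2) := by
    simp only [nullSim_succ_succ, Finset.mul_sum, ← Finset.sum_sub_distrib,
      ← Finset.sum_add_distrib]
    exact Finset.sum_congr rfl fun i _ => by ring
  rw [h, nullSim_zero, nullSim_one]
  ring

lemma abs_det_nullSim {r : ℝ} (hr : 0 < r) (c : Fin d → ℝ) :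
    |LinearMap.det (nullSim r c)| = r ^ (d + 2) := by
  let w : Fin (d + 2) → ℝ := fun k => if k = 0 then 1 else -1
  let B : QuadraticForm ℝ (Fin (d + 2) → ℝ) := QuadraticMap.weightedSumSquares ℝ w
  have hB : ∀ y, B y = lorentzQ (d + 2) y := by
    intro y
    simp only [B, QuadraticMap.weightedSumSquares_apply, lorentzQ, w]
    rw [Finset.sum_filter, Fin.sum_univ_succ, Fin.sum_univ_succ (n := d + 1)]
    simp [Fin.succ_ne_zero]
    ring_nf
  have hdiag : B.toMatrix' = Matrix.diagonal w := by
    ext i j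
    rw [QuadraticForm.toMatrix', LinearMap.toMatrix₂'_apply, QuadraticMap.associated_apply,
      Matrix.diagonal_apply]
    have hpol : ∀ x y : Fin (d + 2) → ℝ, B (x + y) - B x - B y = 2 * ∑ k, w k * x k * y k := by
      intro x y
      simp only [B, QuadraticMap.weightedSumSquares_apply, Finset.mul_sum,
        ← Finset.sum_sub_distrib, Pi.add_apply, smul_eq_mul]
      exact Finset.sum_congr rfl fun k _ => by ring
    rw [hpol]
    by_cases hij : i = j
    · subst hij
      simp [Pi.single_apply]
    · simp [Pi.single_apply, hij, Ne.symm hij]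
  have hdisc : B.discr' ≠ 0 := by
    rw [QuadraticForm.discr', hdiag, Matrix.det_diagonal]
    refine Finset.prod_ne_zero_iff.2 fun k _ => ?_
    simp only [w]; split_ifs <;> norm_num
  have hcomp : B.comp (nullSim r c) = (r ^ 2) • B := by
    ext y
    simp [hB, lorentzQ_nullSim]
  have h1 := QuadraticForm.discr'_comp (Q := B) (nullSim r c)
  rw [hcomp, QuadraticForm.discr'_smul, Fintype.card_fin, LinearMap.det_toMatrix'] at h1
  have h2 : (LinearMap.det (nullSim r c)) ^ 2 = (r ^ (d + 2)) ^ 2 := by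
    have := mul_right_cancel₀ hdisc h1
    rw [sq, ← this]; ring
  rw [← abs_of_pos (pow_pos hr (d + 2))]
  exact (sq_eq_sq_iff_abs_eq_abs _ _).1 h2

lemma mem_lightCone_iff (y : Fin (d + 2) → ℝ) :
    y ∈ lightCone (d + 2) ↔ 0 < y 0 + y 1 ∧ 0 < lorentzQ (d + 2) y := by
  have hs : 0 ≤ ∑ i : Fin d, y i.succ.succ ^ 2 := Finset.sum_nonneg fun i _ => sq_nonneg _
  constructor
  · rintro ⟨h0, hQ⟩
    refine ⟨?_, hQ⟩
    rw [lorentzQ_eq] at hQ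
    by_contra h
    nlinarith
  · rintro ⟨h0, hQ⟩
    refine ⟨?_, hQ⟩
    rw [lorentzQ_eq] at hQ
    have h1 : 0 < (y 0 + y 1) * (y 0 - y 1) := by linarith
    have := (pos_iff_pos_of_mul_pos h1).1 h0
    linarith

lemma nullSim_mem_lightCone_iff {r : ℝ} (hr : 0 < r) (c : Fin d → ℝ) (y : Fin (d + 2) → ℝ) :
    nullSim r c y ∈ lightCone (d + 2) ↔ y ∈ lightCone (d + 2) := by
  have : 0 < r ^ 2 := by positivity
  rw [mem_lightCone_iff, mem_lightCone_iff, nullSim_zero_add_one, lorentzQ_nullSim,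
    mul_pos_iff_of_pos_left this, mul_pos_iff_of_pos_left this]

lemma lorentzQ_le_add {y v : Fin (d + 2) → ℝ} (hy : y ∈ lightCone (d + 2))
    (hv : v ∈ lightCone (d + 2)) : lorentzQ (d + 2) v ≤ lorentzQ (d + 2) (y + v) := by
  rw [mem_lightCone_iff, lorentzQ_eq] at hy hv
  obtain ⟨hy0, hy1⟩ := hy
  obtain ⟨hv0, hv1⟩ := hv
  rw [lorentzQ_eq, lorentzQ_eq]
  have hsum : ∑ i : Fin d, (y + v) i.succ.succ ^ 2 = ∑ i : Fin d, y i.succ.succ ^ 2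
      + 2 * ∑ i : Fin d, y i.succ.succ * v i.succ.succ + ∑ i : Fin d, v i.succ.succ ^ 2 := by
    simp only [Finset.mul_sum, ← Finset.sum_add_distrib, Pi.add_apply]
    exact Finset.sum_congr rfl fun i _ => by ring
  have hcs := Finset.sum_mul_sq_le_sq_mul_sq Finset.univ (fun i : Fin d => y i.succ.succ)
    (fun i : Fin d => v i.succ.succ)
  have hs : 0 ≤ ∑ i : Fin d, y i.succ.succ ^ 2 := Finset.sum_nonneg fun i _ => sq_nonneg _
  have hs' : 0 ≤ ∑ i : Fin d, v i.succ.succ ^ 2 := Finset.sum_nonneg fun i _ => sq_nonneg _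
  rw [hsum]
  simp only [Pi.add_apply]
  generalize ∑ i : Fin d, y i.succ.succ ^ 2 = A at *
  generalize ∑ i : Fin d, v i.succ.succ ^ 2 = B at *
  generalize ∑ i : Fin d, y i.succ.succ * v i.succ.succ = D at *
  have ha : 0 < y 0 - y 1 := (pos_iff_pos_of_mul_pos (by linarith)).1 hy0
  have ha' : 0 < v 0 - v 1 := (pos_iff_pos_of_mul_pos (by linarith)).1 hv0
  have hAB : A * B ≤ ((y 0 + y 1) * (y 0 - y 1)) * ((v 0 + v 1) * (v 0 - v 1)) :=
    mul_le_mul (by linarith) (by linarith) hs' (by positivity)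
  have hk : |2 * D| ≤ (y 0 + y 1) * (v 0 - v 1) + (v 0 + v 1) * (y 0 - y 1) := by
    refine abs_le_of_sq_le_sq ?_ (by positivity)
    nlinarith [sq_nonneg ((y 0 + y 1) * (v 0 - v 1) - (v 0 + v 1) * (y 0 - y 1))]
  have := (abs_le.1 hk).2
  nlinarith

lemma norm_nullSim_le {r : ℝ} (hr0 : 0 ≤ r) (hr1 : r ≤ 1) {c : Fin d → ℝ}
    (hc : ∀ i, |c i| ≤ 1) (y : Fin (d + 2) → ℝ) :
    ‖nullSim r c y‖ ≤ (3 + 2 * d) * ‖y‖ := by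
  have hy : ∀ k, |y k| ≤ ‖y‖ := fun k => norm_le_pi_norm y k
  have hn := norm_nonneg y
  have h1 : |∑ i, c i * y i.succ.succ| ≤ d * ‖y‖ := by
    refine (Finset.abs_sum_le_sum_abs _ _).trans ?_
    have : ∀ i ∈ Finset.univ, |c i * y i.succ.succ| ≤ ‖y‖ := fun i _ => by
      rw [abs_mul]
      nlinarith [hc i, hy i.succ.succ, abs_nonneg (c i), abs_nonneg (y i.succ.succ)]
    simpa using Finset.sum_le_card_nsmul _ _ _ this
  have h2 : ∑ i, c i ^ 2 ≤ d := by
    have : ∀ i ∈ Finset.univ, c i ^ 2 ≤ 1 := fun i _ => by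
      rw [sq_le_one_iff_abs_le_one]; exact hc i
    simpa using Finset.sum_le_card_nsmul _ _ _ this
  have h2' : 0 ≤ ∑ i, c i ^ 2 := Finset.sum_nonneg fun i _ => sq_nonneg _
  have h3 : r ^ 2 ≤ 1 := by nlinarith
  have hb : |y 0 + y 1| ≤ 2 * ‖y‖ := (abs_add_le _ _).trans (by linarith [hy 0, hy 1])
  have ha : |y 0 - y 1| ≤ 2 * ‖y‖ := (abs_sub _ _).trans (by linarith [hy 0, hy 1])
  have h4 : |(∑ i, c i ^ 2) * (y 0 + y 1)| ≤ d * (2 * ‖y‖) := by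
    rw [abs_mul, abs_of_nonneg h2']
    exact mul_le_mul h2 hb (abs_nonneg _) (by positivity)
  have h5 : |r ^ 2 * (y 0 + y 1)| ≤ 2 * ‖y‖ := by
    rw [abs_mul, abs_of_nonneg (sq_nonneg r)]
    nlinarith [abs_nonneg (y 0 + y 1)]
  rw [pi_norm_le_iff_of_nonneg (by positivity)]
  rw [abs_le] at h1 h4 h5 ha
  intro k
  rw [Real.norm_eq_abs]
  refine Fin.cases ?_ (fun k => Fin.cases ?_ (fun i => ?_) k) k
  · rw [nullSim_zero, abs_le]
    constructor <;> nlinarith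
  · rw [show (Fin.succ 0 : Fin (d + 2)) = 1 from rfl, nullSim_one, abs_le]
    constructor <;> nlinarith
  · rw [nullSim_succ_succ, abs_mul, abs_of_nonneg hr0]
    have h6 : |y i.succ.succ - (y 0 + y 1) * c i| ≤ 3 * ‖y‖ := by
      refine (abs_sub _ _).trans ?_
      rw [abs_mul]
      nlinarith [hy i.succ.succ, hc i, abs_nonneg (c i), abs_nonneg (y 0 + y 1)]
    have : (0:ℝ) ≤ d * ‖y‖ := by positivity
    nlinarith [abs_nonneg (y i.succ.succ - (y 0 + y 1) * c i)]

@[fun_prop]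
lemma continuous_lorentzQ (n : ℕ) [NeZero n] : Continuous (lorentzQ n) := by
  unfold lorentzQ; fun_prop

/-- The value of the complexified Lorentz form at `Y - iX`. -/
def tubeQ (X Y : Fin (d + 2) → ℝ) : ℂ :=
  ⟨lorentzQ (d + 2) Y - lorentzQ (d + 2) X,
    -(lorentzQ (d + 2) (X + Y) - lorentzQ (d + 2) X - lorentzQ (d + 2) Y)⟩

lemma continuous_tubeQ :
    Continuous fun z : (Fin (d + 2) → ℝ) × (Fin (d + 2) → ℝ) => tubeQ z.1 z.2 := by
  unfold tubeQ
  simp only [Complex.mk_eq_add_mul_I]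
  fun_prop

lemma lorentzQC_kernel (x y u v : Fin (d + 2) → ℝ) :
    lorentzQC (d + 2) (fun k => (tubePt (d + 2) x y k - ((u k : ℂ) - (v k : ℂ) * Complex.I))
      / Complex.I) = tubeQ (x - u) (y + v) := by
  have h : ∀ k, ((tubePt (d + 2) x y k - ((u k : ℂ) - (v k : ℂ) * Complex.I)) / Complex.I) ^ 2
      = ((((y + v) k) ^ 2 - ((x - u) k) ^ 2 : ℝ) : ℂ)
        + ((-(((x - u + (y + v)) k) ^ 2 - ((x - u) k) ^ 2 - ((y + v) k) ^ 2) : ℝ) : ℂ)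
          * Complex.I := by
    intro k
    rw [div_eq_mul_inv, Complex.inv_I]
    simp only [tubePt, Pi.add_apply, Pi.sub_apply]
    push_cast
    linear_combination ((x k - u k : ℂ) ^ 2 + (y k + v k) ^ 2 * Complex.I ^ 2 - (y k + v k) ^ 2
      + 2 * (x k - u k) * (y k + v k) * Complex.I) * Complex.I_sq
  simp only [lorentzQC, h, tubeQ, lorentzQ, Complex.mk_eq_add_mul_I]
  simp only [Finset.sum_add_distrib, ← Finset.sum_mul, ← Complex.ofReal_sum,
    Finset.sum_sub_distrib, Finset.sum_neg_distrib]
  push_cast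
  ring

lemma tubeQ_nullSim (r : ℝ) (c : Fin d → ℝ) (X Y : Fin (d + 2) → ℝ) :
    tubeQ (nullSim r c X) (nullSim r c Y) = ((r ^ 2 : ℝ) : ℂ) * tubeQ X Y := by
  unfold tubeQ
  rw [← map_add, lorentzQ_nullSim, lorentzQ_nullSim, lorentzQ_nullSim]
  apply Complex.ext
  · rw [Complex.re_ofReal_mul]; ring
  · rw [Complex.im_ofReal_mul]; ring

lemma ofReal_mul_cpow_ofReal {a : ℝ} (ha : 0 < a) (z : ℂ) (t : ℝ) :
    ((a : ℂ) * z) ^ (t : ℂ) = ((a ^ t : ℝ) : ℂ) * z ^ (t : ℂ) := by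
  rcases eq_or_ne z 0 with rfl | hz
  · rcases eq_or_ne t 0 with rfl | ht
    · simp
    · have : (t : ℂ) ≠ 0 := by exact_mod_cast ht
      simp [Complex.zero_cpow this]
  · have ha' : (a : ℂ) ≠ 0 := by exact_mod_cast ha.ne'
    rw [Complex.cpow_def_of_ne_zero (mul_ne_zero ha' hz), Complex.cpow_def_of_ne_zero hz,
      Complex.log_ofReal_mul ha hz, Complex.ofReal_cpow ha.le, Complex.cpow_def_of_ne_zero ha',
      ← Complex.exp_add, Complex.ofReal_log ha.le]
    ring_nf

lemma eventually_tubeQ_cpow_bounds (B s : ℝ) (hs : 0 < s) :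
    ∃ κ > 0, ∃ κ' : ℝ, ∀ᶠ X in 𝓝 (0 : Fin (d + 2) → ℝ),
      ∀ Y : Fin (d + 2) → ℝ, ‖Y‖ ≤ B → 1 / 2 ≤ lorentzQ (d + 2) Y →
        κ ≤ (tubeQ X Y ^ ((-s : ℝ) : ℂ)).re ∧ ‖tubeQ X Y ^ ((-s : ℝ) : ℂ)‖ ≤ κ' := by
  have hK : IsCompact (Metric.closedBall (0 : Fin (d + 2) → ℝ) B ∩
      {Y | 1 / 2 ≤ lorentzQ (d + 2) Y}) :=
    (isCompact_closedBall _ _).inter_right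
      (isClosed_le continuous_const (continuous_lorentzQ _))
  have hpos : (0 : ℝ) < 1 + B ^ 2 := by positivity
  refine ⟨1 / 2 * (1 + B ^ 2) ^ (-s), by positivity, 2 * (1 / 2 : ℝ) ^ (-s), ?_⟩
  have key := hK.eventually_forall_of_forall_eventually (x₀ := (0 : Fin (d + 2) → ℝ))
    (P := fun X Y => 1 / 2 * (1 + B ^ 2) ^ (-s) < (tubeQ X Y ^ ((-s : ℝ) : ℂ)).re ∧
      ‖tubeQ X Y ^ ((-s : ℝ) : ℂ)‖ < 2 * (1 / 2 : ℝ) ^ (-s)) ?_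
  · filter_upwards [key] with X hX Y hY hQ
    have := hX Y ⟨by simpa using hY, hQ⟩
    exact ⟨this.1.le, this.2.le⟩
  · rintro Y ⟨hY, hQ⟩
    have hY : ‖Y‖ ≤ B := by simpa using hY
    have hQ : 1 / 2 ≤ lorentzQ (d + 2) Y := hQ
    have h0 : tubeQ 0 Y = (lorentzQ (d + 2) Y : ℂ) := by
      have hz : lorentzQ (d + 2) (0 : Fin (d + 2) → ℝ) = 0 := by simp [lorentzQ]
      apply Complex.ext <;> simp [tubeQ, hz]
    have hQle : lorentzQ (d + 2) Y ≤ 1 + B ^ 2 := by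
      have h1 : lorentzQ (d + 2) Y ≤ Y 0 ^ 2 :=
        sub_le_self _ (Finset.sum_nonneg fun i _ => sq_nonneg _)
      have h2 : |Y 0| ≤ B := (norm_le_pi_norm Y 0).trans hY
      have h3 := (sq_le_sq' (abs_le.1 h2).1 (abs_le.1 h2).2)
      linarith
    have hval : tubeQ 0 Y ^ ((-s : ℝ) : ℂ) = ((lorentzQ (d + 2) Y ^ (-s) : ℝ) : ℂ) := by
      rw [h0, Complex.ofReal_cpow (by linarith)]
    have hlow : (1 + B ^ 2) ^ (-s) ≤ lorentzQ (d + 2) Y ^ (-s) :=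
      Real.rpow_le_rpow_of_nonpos (by linarith) hQle (by linarith)
    have hup : lorentzQ (d + 2) Y ^ (-s) ≤ (1 / 2 : ℝ) ^ (-s) :=
      Real.rpow_le_rpow_of_nonpos (by norm_num) hQ (by linarith)
    have hc : ContinuousAt (fun z : (Fin (d + 2) → ℝ) × (Fin (d + 2) → ℝ) =>
        tubeQ z.1 z.2 ^ ((-s : ℝ) : ℂ)) (0, Y) := by
      refine (continuous_tubeQ.continuousAt).cpow continuousAt_const ?_
      left
      simp only [h0, Complex.ofReal_re]
      linarith
    have hp1 : (0 : ℝ) < (1 + B ^ 2) ^ (-s) := by positivity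
    have hp2 : (0 : ℝ) < (1 / 2 : ℝ) ^ (-s) := by positivity
    have e1 : 1 / 2 * (1 + B ^ 2) ^ (-s) < (tubeQ 0 Y ^ ((-s : ℝ) : ℂ)).re := by
      rw [hval, Complex.ofReal_re]; linarith
    have e2 : ‖tubeQ 0 Y ^ ((-s : ℝ) : ℂ)‖ < 2 * (1 / 2 : ℝ) ^ (-s) := by
      rw [hval, Complex.norm_real, Real.norm_eq_abs, abs_of_pos (by linarith)]
      linarith
    exact ((Complex.continuous_re.continuousAt.comp hc).eventually (eventually_gt_nhds e1)).and
      (hc.norm.eventually (eventually_lt_nhds e2))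

lemma lorentzQ_add_smul_eVec (X : Fin (d + 2) → ℝ) (t : ℝ) :
    lorentzQ (d + 2) (X + t • eVec (d + 2)) = lorentzQ (d + 2) X + 2 * t * X 0 + t ^ 2 := by
  have : ∀ i : Fin d, (X + t • eVec (d + 2)) i.succ.succ = X i.succ.succ := by
    intro i; simp [eVec, Fin.succ_ne_zero]
  rw [lorentzQ_eq, lorentzQ_eq]
  simp only [this]
  simp [eVec]
  ring

lemma le_norm_tubeQ_add_smul_eVec (ρ L : ℝ) :
    ∃ T > 0, ∀ (X Y : Fin (d + 2) → ℝ) (t : ℝ), ‖X‖ ≤ ρ → ‖Y‖ ≤ ρ → 1 / 2 ≤ Y 0 → T ≤ |t| →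
      L ≤ ‖tubeQ (X + t • eVec (d + 2)) Y‖ := by
  obtain ⟨C, hC⟩ := ((isCompact_closedBall (0 : Fin (d + 2) → ℝ) ρ).prod
    (isCompact_closedBall (0 : Fin (d + 2) → ℝ) ρ)).exists_bound_of_continuousOn
    (f := fun z => lorentzQ (d + 2) (z.1 + z.2) - lorentzQ (d + 2) z.1 - lorentzQ (d + 2) z.2)
    (by fun_prop)
  refine ⟨|L| + |C| + 1, by positivity, fun X Y t hX hY hY0 ht => ?_⟩
  have hb := hC (X, Y) ⟨by simpa using hX, by simpa using hY⟩
  refine le_trans ?_ (Complex.abs_im_le_norm _)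
  have him : (tubeQ (X + t • eVec (d + 2)) Y).im =
      -(2 * t * Y 0 + (lorentzQ (d + 2) (X + Y) - lorentzQ (d + 2) X - lorentzQ (d + 2) Y)) := by
    simp only [tubeQ]
    rw [add_right_comm, lorentzQ_add_smul_eVec, lorentzQ_add_smul_eVec, Pi.add_apply]
    ring
  rw [him, abs_neg]
  simp only [Real.norm_eq_abs] at hb
  have h1 : |t| ≤ |2 * t * Y 0| := by
    rw [abs_mul, abs_mul, abs_of_pos (by linarith : 0 < Y 0), abs_two]
    nlinarith [abs_nonneg t]
  have h2 := abs_sub_abs_le_abs_sub (2 * t * Y 0)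
    (-(lorentzQ (d + 2) (X + Y) - lorentzQ (d + 2) X - lorentzQ (d + 2) Y))
  rw [abs_neg, sub_neg_eq_add] at h2
  linarith [le_abs_self L, le_abs_self C]

section StepFunctions

variable {n : ℕ} {J : Type*} [Fintype J]

/-- The function on the tube equal to `c j` at `x + iy` with `x ∈ U j`, `y ∈ V j`. -/
def tubeStep (c : J → ℝ) (U V : J → Set (Fin n → ℝ)) (z : Fin n → ℂ) : ℂ :=
  ∑ j, (U j ×ˢ V j).indicator (fun _ => (c j : ℂ))
    ((fun k => (z k).re), (fun k => (z k).im))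

lemma tubeStep_tubePt (c : J → ℝ) (U V : J → Set (Fin n → ℝ)) (x y : Fin n → ℝ) :
    tubeStep c U V (tubePt n x y) =
      ∑ j, (U j ×ˢ V j).indicator (fun _ => (c j : ℂ)) (x, y) := by
  simp [tubeStep, tubePt]

lemma measurable_tubeStep (c : J → ℝ) {U V : J → Set (Fin n → ℝ)}
    (hU : ∀ j, MeasurableSet (U j)) (hV : ∀ j, MeasurableSet (V j)) :
    Measurable (tubeStep c U V) := by
  unfold tubeStep
  refine Finset.measurable_sum _ fun j _ => ?_
  refine (measurable_const.indicator ((hU j).prod (hV j))).comp ?_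
  fun_prop

lemma lintegral_tubeStep_le {p q : ℝ} (hp : 0 < p) (hq : 0 < q) {c : J → ℝ} (hc : ∀ j, 0 ≤ c j)
    {U V : J → Set (Fin n → ℝ)} (hU : ∀ j, MeasurableSet (U j)) (hV : ∀ j, MeasurableSet (V j))
    (hd : ∀ i j, ∀ y, y ∈ V i → y ∈ V j → i = j) {w : (Fin n → ℝ) → ℝ≥0∞} (hw : Measurable w)
    (A : Set (Fin n → ℝ)) :
    ∫⁻ y in A, (∫⁻ x, (‖tubeStep c U V (tubePt n x y)‖₊ : ℝ≥0∞) ^ p) ^ (q / p) * w y ≤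
      ∑ j, (ENNReal.ofReal (c j) ^ p * volume (U j)) ^ (q / p) * ∫⁻ y in V j, w y := by
  classical
  refine (setLIntegral_le_lintegral _ _).trans ?_
  have key : ∀ y, (∫⁻ x, (‖tubeStep c U V (tubePt n x y)‖₊ : ℝ≥0∞) ^ p) ^ (q / p) * w y =
      ∑ j, (V j).indicator
        (fun y => (ENNReal.ofReal (c j) ^ p * volume (U j)) ^ (q / p) * w y) y := by
    intro y
    by_cases hy : ∃ j, y ∈ V j
    · obtain ⟨j, hj⟩ := hy
      rw [Finset.sum_eq_single j (fun i _ hij => indicator_of_notMem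
        (fun hi => hij (hd i j y hi hj)) _) (by simp), indicator_of_mem hj]
      have : ∀ x, (‖tubeStep c U V (tubePt n x y)‖₊ : ℝ≥0∞) ^ p =
          (U j).indicator (fun _ => ENNReal.ofReal (c j) ^ p) x := by
        intro x
        rw [tubeStep_tubePt, Finset.sum_eq_single j (fun i _ hij => indicator_of_notMem
          (fun hi => hij (hd i j y hi.2 hj)) _) (by simp)]
        by_cases hx : x ∈ U j
        · rw [indicator_of_mem hx, indicator_of_mem (show (x, y) ∈ U j ×ˢ V j from ⟨hx, hj⟩)]
          congr 1
          rw [← Complex.norm_of_nonneg (hc j), ofReal_norm]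
          simp [enorm_eq_nnnorm]
        · rw [indicator_of_notMem hx, indicator_of_notMem (fun h => hx h.1)]
          simp [hp]
      simp only [this]
      rw [lintegral_indicator (hU j), setLIntegral_const]
    · push Not at hy
      have : ∀ x, (‖tubeStep c U V (tubePt n x y)‖₊ : ℝ≥0∞) ^ p = 0 := by
        intro x
        rw [tubeStep_tubePt, Finset.sum_eq_zero (fun i _ => indicator_of_notMem
          (fun hi => hy i hi.2) _)]
        simp [hp]
      rw [Finset.sum_eq_zero (fun i _ => indicator_of_notMem (hy i) _)]
      simp [this, div_pos hq hp]
  simp only [key]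
  rw [lintegral_finsetSum _ fun j _ => (hw.const_mul _).indicator (hV j)]
  refine Finset.sum_le_sum fun j _ => ?_
  rw [lintegral_indicator (hV j), lintegral_const_mul _ hw]

lemma le_lintegral_of_le_norm {p q : ℝ} (hp : 0 < p) (hq : 0 < q) {a : J → ℝ}
    {U : J → Set (Fin n → ℝ)} (hU : ∀ j, MeasurableSet (U j))
    (hd : ∀ i j, ∀ x, x ∈ U i → x ∈ U j → i = j) {w : (Fin n → ℝ) → ℝ≥0∞} (hw : Measurable w)
    {S A : Set (Fin n → ℝ)} (hS : MeasurableSet S) (hSA : S ⊆ A) {G : (Fin n → ℂ) → ℂ}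
    (hG : ∀ j, ∀ x ∈ U j, ∀ y ∈ S, a j ≤ ‖G (tubePt n x y)‖) :
    (∑ j, ENNReal.ofReal (a j) ^ p * volume (U j)) ^ (q / p) * ∫⁻ y in S, w y ≤
      ∫⁻ y in A, (∫⁻ x, (‖G (tubePt n x y)‖₊ : ℝ≥0∞) ^ p) ^ (q / p) * w y := by
  classical
  refine le_trans ?_ (lintegral_mono_set hSA)
  rw [← lintegral_const_mul _ hw]
  refine setLIntegral_mono' hS fun y hy => ?_
  gcongr
  have : ∑ j, ENNReal.ofReal (a j) ^ p * volume (U j) =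
      ∫⁻ x, ∑ j, (U j).indicator (fun _ => ENNReal.ofReal (a j) ^ p) x := by
    rw [lintegral_finsetSum _ fun j _ => measurable_const.indicator (hU j)]
    refine Finset.sum_congr rfl fun j _ => ?_
    rw [lintegral_indicator (hU j), setLIntegral_const]
  rw [this]
  refine lintegral_mono fun x => ?_
  by_cases hx : ∃ j, x ∈ U j
  · obtain ⟨j, hj⟩ := hx
    rw [Finset.sum_eq_single j (fun i _ hij => indicator_of_notMem
      (fun hi => hij (hd i j x hi hj)) _) (by simp), indicator_of_mem hj]
    gcongr
    rw [← enorm_eq_nnnorm, ← ofReal_norm]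
    exact ENNReal.ofReal_le_ofReal (hG j x hj y hy)
  · push Not at hx
    rw [Finset.sum_eq_zero (fun i _ => indicator_of_notMem (hx i) _)]
    exact zero_le

lemma bergmanOp_tubeStep (ν : ℝ) (c : J → ℝ) {U V : J → Set (Fin (d + 2) → ℝ)}
    (hU : ∀ j, MeasurableSet (U j)) (hV : ∀ j, MeasurableSet (V j))
    (hVc : ∀ j, V j ⊆ lightCone (d + 2)) (x y : Fin (d + 2) → ℝ)
    (hint : ∀ j, IntegrableOn (fun uv : (Fin (d + 2) → ℝ) × (Fin (d + 2) → ℝ) =>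
      tubeQ (x - uv.1) (y + uv.2) ^ ((-(ν + ((d + 2 : ℕ) : ℝ) / 2) : ℝ) : ℂ)
        * ((lorentzQ (d + 2) uv.2 ^ (ν - ((d + 2 : ℕ) : ℝ) / 2) : ℝ) : ℂ)) (U j ×ˢ V j)) :
    bergmanOp (d + 2) ν (tubeStep c U V) (tubePt (d + 2) x y) =
      ∑ j, (c j : ℂ) * ∫ uv in U j ×ˢ V j,
        tubeQ (x - uv.1) (y + uv.2) ^ ((-(ν + ((d + 2 : ℕ) : ℝ) / 2) : ℝ) : ℂ)
        * ((lorentzQ (d + 2) uv.2 ^ (ν - ((d + 2 : ℕ) : ℝ) / 2) : ℝ) : ℂ) := by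
  unfold bergmanOp
  have key : ∀ uv : (Fin (d + 2) → ℝ) × (Fin (d + 2) → ℝ),
      bergmanIntegrand (d + 2) ν (tubeStep c U V) (tubePt (d + 2) x y) uv =
        ∑ j, (U j ×ˢ V j).indicator (fun uv => (c j : ℂ) *
          (tubeQ (x - uv.1) (y + uv.2) ^ ((-(ν + ((d + 2 : ℕ) : ℝ) / 2) : ℝ) : ℂ)
        * ((lorentzQ (d + 2) uv.2 ^ (ν - ((d + 2 : ℕ) : ℝ) / 2) : ℝ) : ℂ))) uv := by
    intro uv
    unfold bergmanIntegrand
    rw [lorentzQC_kernel, tubeStep_tubePt, Finset.mul_sum, Finset.sum_mul]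
    refine Finset.sum_congr rfl fun j _ => ?_
    by_cases h : uv ∈ U j ×ˢ V j
    · rw [indicator_of_mem h, indicator_of_mem h]; ring
    · rw [indicator_of_notMem h, indicator_of_notMem h]; ring
  simp only [key]
  have hm : ∀ j, MeasurableSet (U j ×ˢ V j) := fun j => (hU j).prod (hV j)
  rw [integral_finsetSum _ fun j _ =>
    ((integrable_indicator_iff (hm j)).2 ((hint j).const_mul _)).integrableOn]
  refine Finset.sum_congr rfl fun j _ => ?_
  rw [setIntegral_indicator (hm j), inter_eq_right.2 (prod_mono (subset_univ _) (hVc j)),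
    integral_const_mul]

end StepFunctions

/-- Radii `ε` around `0` and `e` at which the Bergman kernel of index `ν` has nearly constant
phase, with lower and upper bounds `κ`, `κ'`. -/
structure IsKernelScale (d : ℕ) (ν ε κ κ' : ℝ) : Prop where
  pos : 0 < ε
  le_eighth : ε ≤ 1 / 8
  kappa_pos : 0 < κ
  half_le : ∀ v ∈ Metric.ball (eVec (d + 2)) ε, 1 / 2 ≤ lorentzQ (d + 2) v
  half_le_rpow : ∀ v ∈ Metric.ball (eVec (d + 2)) ε,
    1 / 2 ≤ lorentzQ (d + 2) v ^ (ν - ((d + 2 : ℕ) : ℝ) / 2)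
  rpow_le_two : ∀ v ∈ Metric.ball (eVec (d + 2)) ε,
    lorentzQ (d + 2) v ^ (ν - ((d + 2 : ℕ) : ℝ) / 2) ≤ 2
  le_re_cpow : ∀ X ∈ Metric.ball (0 : Fin (d + 2) → ℝ) (2 * ε), ∀ Y : Fin (d + 2) → ℝ,
    ‖Y‖ ≤ (3 + 2 * d) * 2 + 2 → 1 / 2 ≤ lorentzQ (d + 2) Y →
      κ ≤ (tubeQ X Y ^ ((-(ν + ((d + 2 : ℕ) : ℝ) / 2) : ℝ) : ℂ)).re
  norm_cpow_le : ∀ X ∈ Metric.ball (0 : Fin (d + 2) → ℝ) (2 * ε), ∀ Y : Fin (d + 2) → ℝ,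
    ‖Y‖ ≤ (3 + 2 * d) * 2 + 2 → 1 / 2 ≤ lorentzQ (d + 2) Y →
      ‖tubeQ X Y ^ ((-(ν + ((d + 2 : ℕ) : ℝ) / 2) : ℝ) : ℂ)‖ ≤ κ'

lemma lorentzQ_eVec : lorentzQ (d + 2) (eVec (d + 2)) = 1 := by
  have : ∀ i : Fin d, eVec (d + 2) i.succ.succ = 0 := fun i => by simp [eVec, Fin.succ_ne_zero]
  rw [lorentzQ_eq]
  simp only [this]
  simp [eVec]

lemma exists_isKernelScale (d : ℕ) {ν : ℝ} (hν : 0 < ν) :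
    ∃ ε κ κ', IsKernelScale d ν ε κ κ' := by
  obtain ⟨κ, hκ, κ', hev⟩ := eventually_tubeQ_cpow_bounds (d := d) ((3 + 2 * d) * 2 + 2)
    (ν + ((d + 2 : ℕ) : ℝ) / 2) (by positivity)
  obtain ⟨δ, hδ, hX⟩ := Metric.eventually_nhds_iff_ball.1 hev
  have hQ := (continuous_lorentzQ (d + 2)).continuousAt (x := eVec (d + 2))
  have hQ' : ContinuousAt (fun v => lorentzQ (d + 2) v ^ (ν - ((d + 2 : ℕ) : ℝ) / 2))
      (eVec (d + 2)) := hQ.rpow_const (Or.inl (by rw [lorentzQ_eVec]; norm_num))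
  have h1 := hQ.eventually (eventually_gt_nhds
    (show 1 / 2 < lorentzQ (d + 2) (eVec (d + 2)) by rw [lorentzQ_eVec]; norm_num))
  have h2 := hQ'.eventually (eventually_gt_nhds
    (show 1 / 2 < lorentzQ (d + 2) (eVec (d + 2)) ^ (ν - ((d + 2 : ℕ) : ℝ) / 2) by
      rw [lorentzQ_eVec, Real.one_rpow]; norm_num))
  have h3 := hQ'.eventually (eventually_lt_nhds
    (show lorentzQ (d + 2) (eVec (d + 2)) ^ (ν - ((d + 2 : ℕ) : ℝ) / 2) < 2 by
      rw [lorentzQ_eVec, Real.one_rpow]; norm_num))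
  obtain ⟨η, hη, hv⟩ := Metric.eventually_nhds_iff_ball.1 (h1.and (h2.and h3))
  refine ⟨min (1 / 8) (min (δ / 2) η), κ, κ', by positivity, min_le_left _ _, hκ, ?_, ?_, ?_,
    ?_, ?_⟩
  · exact fun v h => (hv v (Metric.ball_subset_ball
      ((min_le_right _ _).trans (min_le_right _ _)) h)).1.le
  · exact fun v h => (hv v (Metric.ball_subset_ball
      ((min_le_right _ _).trans (min_le_right _ _)) h)).2.1.le
  · exact fun v h => (hv v (Metric.ball_subset_ball
      ((min_le_right _ _).trans (min_le_right _ _)) h)).2.2.le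
  all_goals
    intro X hX' Y hY hYQ
    have hle : 2 * min (1 / 8) (min (δ / 2) η) ≤ δ := by
      have := (min_le_right (1 / 8) (min (δ / 2) η)).trans (min_le_left _ _)
      linarith
  · exact (hX X (Metric.ball_subset_ball hle hX') Y hY hYQ).1
  · exact (hX X (Metric.ball_subset_ball hle hX') Y hY hYQ).2

/-- A translate of the inverse image of a ball around the origin under a null similarity. -/
def xCell (ε r : ℝ) (c : Fin d → ℝ) (x₀ : Fin (d + 2) → ℝ) : Set (Fin (d + 2) → ℝ) :=
  {x | nullSim r c (x - x₀) ∈ Metric.ball 0 ε}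

/-- The inverse image of a ball around `e` under a null similarity. -/
def yCell (ε r : ℝ) (c : Fin d → ℝ) : Set (Fin (d + 2) → ℝ) :=
  {v | nullSim r c v ∈ Metric.ball (eVec (d + 2)) ε}

lemma measurable_nullSim (r : ℝ) (c : Fin d → ℝ) : Measurable (nullSim r c) :=
  (nullSim r c).continuous_of_finiteDimensional.measurable

lemma measurableSet_xCell (ε r : ℝ) (c : Fin d → ℝ) (x₀ : Fin (d + 2) → ℝ) :
    MeasurableSet (xCell ε r c x₀) :=
  ((measurable_nullSim r c).comp (measurable_id.sub_const x₀)) measurableSet_ball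

lemma measurableSet_yCell (ε r : ℝ) (c : Fin d → ℝ) : MeasurableSet (yCell ε r c) :=
  measurable_nullSim r c measurableSet_ball

lemma det_nullSim_ne_zero {r : ℝ} (hr : 0 < r) (c : Fin d → ℝ) :
    LinearMap.det (nullSim r c) ≠ 0 := by
  rw [← abs_pos, abs_det_nullSim hr]; positivity

lemma volume_yCell {r : ℝ} (hr : 0 < r) (ε : ℝ) (c : Fin d → ℝ) :
    volume (yCell ε r c) = ENNReal.ofReal ((r ^ (d + 2))⁻¹) *
      volume (Metric.ball (0 : Fin (d + 2) → ℝ) ε) := by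
  have := Measure.addHaar_preimage_linearMap volume (det_nullSim_ne_zero hr c)
    (Metric.ball (eVec (d + 2)) ε)
  rw [abs_inv, abs_det_nullSim hr, Measure.addHaar_ball_center] at this
  exact this

lemma volume_xCell {r : ℝ} (hr : 0 < r) (ε : ℝ) (c : Fin d → ℝ) (x₀ : Fin (d + 2) → ℝ) :
    volume (xCell ε r c x₀) = ENNReal.ofReal ((r ^ (d + 2))⁻¹) *
      volume (Metric.ball (0 : Fin (d + 2) → ℝ) ε) := by
  have := Measure.addHaar_preimage_linearMap volume (det_nullSim_ne_zero hr c)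
    (Metric.ball (0 : Fin (d + 2) → ℝ) ε)
  rw [abs_inv, abs_det_nullSim hr] at this
  rw [← this]
  exact (measurePreserving_sub_right volume x₀).measure_preimage
    (measurable_nullSim r c measurableSet_ball).nullMeasurableSet

lemma exists_norm_le_of_nullSim {r : ℝ} (hr : 0 < r) (c : Fin d → ℝ) (B : ℝ) :
    ∃ ρ, ∀ x, ‖nullSim r c x‖ ≤ B → ‖x‖ ≤ ρ := by
  have hker : LinearMap.ker (nullSim r c) = ⊥ :=
    LinearMap.ker_eq_bot.2 (LinearMap.equivOfDetNeZero _ (det_nullSim_ne_zero hr c)).injective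
  obtain ⟨K, -, hK⟩ := (nullSim r c).exists_antilipschitzWith hker
  refine ⟨K * B, fun x hx => ?_⟩
  have := hK.le_mul_dist x 0
  rw [map_zero, dist_zero_right, dist_zero_right] at this
  exact this.trans (by gcongr)

/-- The weighted Bergman kernel, `(uv)` being the point `u + iv` of integration. -/
def tubeKernel (ν : ℝ) (x y : Fin (d + 2) → ℝ)
    (uv : (Fin (d + 2) → ℝ) × (Fin (d + 2) → ℝ)) : ℂ :=
  tubeQ (x - uv.1) (y + uv.2) ^ ((-(ν + ((d + 2 : ℕ) : ℝ) / 2) : ℝ) : ℂ)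
    * ((lorentzQ (d + 2) uv.2 ^ (ν - ((d + 2 : ℕ) : ℝ) / 2) : ℝ) : ℂ)

lemma measurable_tubeKernel (ν : ℝ) (x y : Fin (d + 2) → ℝ) :
    Measurable (tubeKernel ν x y) := by
  have h1 : Measurable fun uv : (Fin (d + 2) → ℝ) × (Fin (d + 2) → ℝ) =>
      tubeQ (x - uv.1) (y + uv.2) :=
    (continuous_tubeQ.comp (by fun_prop : Continuous
      fun uv : (Fin (d + 2) → ℝ) × (Fin (d + 2) → ℝ) => (x - uv.1, y + uv.2))).measurable
  have h2 : Measurable fun uv : (Fin (d + 2) → ℝ) × (Fin (d + 2) → ℝ) =>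
      lorentzQ (d + 2) uv.2 := (by fun_prop : Continuous _).measurable
  exact (h1.pow_const _).mul (Complex.measurable_ofReal.comp (h2.pow_const _))

lemma lorentzQ_rpow_nullSim {r : ℝ} (hr : 0 < r) (c : Fin d → ℝ) (v : Fin (d + 2) → ℝ)
    (hv : 0 ≤ lorentzQ (d + 2) v) (t : ℝ) :
    lorentzQ (d + 2) v ^ t = r ^ (-(2 * t)) * lorentzQ (d + 2) (nullSim r c v) ^ t := by
  rw [lorentzQ_nullSim, Real.mul_rpow (by positivity) hv, ← mul_assoc, ← Real.rpow_natCast r 2,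
    ← Real.rpow_mul hr.le, ← Real.rpow_add hr]
  simp

lemma tubeKernel_nullSim {r : ℝ} (hr : 0 < r) (c : Fin d → ℝ) (ν : ℝ)
    (x y : Fin (d + 2) → ℝ) (uv : (Fin (d + 2) → ℝ) × (Fin (d + 2) → ℝ))
    (hv : 0 ≤ lorentzQ (d + 2) uv.2) :
    tubeKernel ν x y uv = ((r ^ (d + 2) * r ^ (d + 2) *
        lorentzQ (d + 2) (nullSim r c uv.2) ^ (ν - ((d + 2 : ℕ) : ℝ) / 2) : ℝ) : ℂ) *
      tubeQ (nullSim r c (x - uv.1)) (nullSim r c y + nullSim r c uv.2) ^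
        ((-(ν + ((d + 2 : ℕ) : ℝ) / 2) : ℝ) : ℂ) := by
  rw [tubeKernel, lorentzQ_rpow_nullSim hr c _ hv, ← map_add, tubeQ_nullSim,
    ofReal_mul_cpow_ofReal (by positivity), ← Real.rpow_natCast r 2, ← Real.rpow_mul hr.le,
    ← Real.rpow_natCast r (d + 2)]
  have : r ^ (-(2 * (ν - ((d + 2 : ℕ) : ℝ) / 2))) =
      r ^ (((d + 2 : ℕ) : ℝ)) * r ^ (((d + 2 : ℕ) : ℝ)) *
        r ^ (((2 : ℕ) : ℝ) * -(ν + ((d + 2 : ℕ) : ℝ) / 2)) := by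
    rw [← Real.rpow_add hr, ← Real.rpow_add hr]
    congr 1
    push_cast
    ring
  rw [this]
  push_cast
  ring


section Cells

variable {ν ε κ κ' : ℝ}

lemma abs_sub_lt_of_mem_ball_eVec {v : Fin (d + 2) → ℝ} (hε : ε ≤ 1 / 8)
    (hv : v ∈ Metric.ball (eVec (d + 2)) ε) :
    |v 0 - 1| < 1 / 8 ∧ |v 1| < 1 / 8 ∧ ∀ i : Fin d, |v i.succ.succ| < 1 / 8 := by
  rw [mem_ball_iff_norm] at hv
  have h : ∀ k, |(v - eVec (d + 2)) k| < 1 / 8 := fun k =>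
    (norm_le_pi_norm (v - eVec (d + 2)) k).trans_lt (hv.trans_le hε)
  exact ⟨by simpa [eVec] using h 0, by simpa [eVec] using h 1,
    fun i => by simpa [eVec, Fin.succ_ne_zero] using h i.succ.succ⟩

lemma IsKernelScale.ball_subset (hs : IsKernelScale d ν ε κ κ') :
    Metric.ball (eVec (d + 2)) ε ⊆ lightCone (d + 2) := by
  intro v hv
  obtain ⟨h0, -, -⟩ := abs_sub_lt_of_mem_ball_eVec hs.le_eighth hv
  rw [abs_lt] at h0
  exact ⟨by linarith, by linarith [hs.half_le v hv]⟩

lemma IsKernelScale.yCell_subset (hs : IsKernelScale d ν ε κ κ') {r : ℝ} (hr : 0 < r)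
    (c : Fin d → ℝ) : yCell ε r c ⊆ lightCone (d + 2) := fun v hv =>
  (nullSim_mem_lightCone_iff hr c v).1 (hs.ball_subset hv)

lemma norm_le_two_of_mem_ball_eVec {v : Fin (d + 2) → ℝ} (hε : ε ≤ 1 / 8)
    (hv : v ∈ Metric.ball (eVec (d + 2)) ε) : ‖v‖ ≤ 2 := by
  obtain ⟨h0, h1, h2⟩ := abs_sub_lt_of_mem_ball_eVec hε hv
  rw [pi_norm_le_iff_of_nonneg (by norm_num)]
  intro k
  rw [Real.norm_eq_abs]
  refine Fin.cases ?_ (fun k => Fin.cases ?_ (fun i => ?_) k) k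
  · rw [abs_lt] at h0; rw [abs_le]; constructor <;> linarith
  · exact h1.le.trans (by norm_num)
  · exact (h2 i).le.trans (by norm_num)

lemma IsKernelScale.tubeKernel_bounds (hs : IsKernelScale d ν ε κ κ') {r : ℝ} (hr : 0 < r)
    (hr1 : r ≤ 1) {c : Fin d → ℝ} (hc : ∀ i, |c i| ≤ 1) {x₀ x y : Fin (d + 2) → ℝ}
    (hx : x ∈ xCell ε r c x₀) (hy : y ∈ Metric.ball (eVec (d + 2)) ε)
    {uv : (Fin (d + 2) → ℝ) × (Fin (d + 2) → ℝ)} (huv : uv ∈ xCell ε r c x₀ ×ˢ yCell ε r c) :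
    r ^ (d + 2) * r ^ (d + 2) * (κ / 2) ≤ (tubeKernel ν x y uv).re ∧
      ‖tubeKernel ν x y uv‖ ≤ r ^ (d + 2) * r ^ (d + 2) * 2 * κ' := by
  obtain ⟨hu, hv⟩ := huv
  have hQv : 0 ≤ lorentzQ (d + 2) uv.2 := (hs.yCell_subset hr c hv).2.le
  have hX : nullSim r c (x - uv.1) ∈ Metric.ball (0 : Fin (d + 2) → ℝ) (2 * ε) := by
    have h1 : ‖nullSim r c (x - x₀)‖ < ε := by simpa [xCell] using hx
    have h2 : ‖nullSim r c (uv.1 - x₀)‖ < ε := by simpa [xCell] using hu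
    rw [mem_ball_zero_iff, show x - uv.1 = (x - x₀) - (uv.1 - x₀) by abel, map_sub]
    exact (norm_sub_le _ _).trans_lt (by linarith)
  have hyn : ‖nullSim r c y‖ ≤ (3 + 2 * d) * 2 :=
    (norm_nullSim_le hr.le hr1 hc y).trans (by
      gcongr; exact norm_le_two_of_mem_ball_eVec hs.le_eighth hy)
  have hY : ‖nullSim r c y + nullSim r c uv.2‖ ≤ (3 + 2 * d) * 2 + 2 :=
    (norm_add_le _ _).trans (add_le_add hyn (norm_le_two_of_mem_ball_eVec hs.le_eighth hv))
  have hQ : 1 / 2 ≤ lorentzQ (d + 2) (nullSim r c y + nullSim r c uv.2) :=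
    (hs.half_le _ hv).trans (lorentzQ_le_add
      ((nullSim_mem_lightCone_iff hr c y).2 (hs.ball_subset hy)) (hs.ball_subset hv))
  have h1 := hs.half_le_rpow _ hv
  have h2 := hs.rpow_le_two _ hv
  have h3 := hs.le_re_cpow _ hX _ hY hQ
  have h4 := hs.norm_cpow_le _ hX _ hY hQ
  have hκ := hs.kappa_pos
  have hrr : 0 < r ^ (d + 2) * r ^ (d + 2) := by positivity
  rw [tubeKernel_nullSim hr c ν x y uv hQv]
  constructor
  · rw [Complex.re_ofReal_mul, mul_assoc (r ^ (d + 2) * r ^ (d + 2))]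
    gcongr
    nlinarith
  · rw [norm_mul, Complex.norm_real, Real.norm_eq_abs, abs_of_nonneg (by positivity)]
    gcongr

lemma volume_cell_lt_top {r : ℝ} (hr : 0 < r) (ε : ℝ) (c : Fin d → ℝ) (x₀ : Fin (d + 2) → ℝ) :
    volume (xCell ε r c x₀ ×ˢ yCell ε r c) < ∞ := by
  rw [Measure.volume_eq_prod, Measure.prod_prod, volume_xCell hr, volume_yCell hr]
  exact ENNReal.mul_lt_top (ENNReal.mul_lt_top ENNReal.ofReal_lt_top measure_ball_lt_top)
    (ENNReal.mul_lt_top ENNReal.ofReal_lt_top measure_ball_lt_top)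

lemma volume_real_cell {r : ℝ} (hr : 0 < r) (ε : ℝ) (c : Fin d → ℝ) (x₀ : Fin (d + 2) → ℝ) :
    volume.real (xCell ε r c x₀ ×ˢ yCell ε r c) =
      (r ^ (d + 2) * r ^ (d + 2))⁻¹ *
        volume.real (Metric.ball (0 : Fin (d + 2) → ℝ) ε) ^ 2 := by
  rw [measureReal_def, Measure.volume_eq_prod, Measure.prod_prod, volume_xCell hr,
    volume_yCell hr, ENNReal.toReal_mul, ENNReal.toReal_mul, ENNReal.toReal_ofReal (by positivity),
    measureReal_def, mul_inv]
  ring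

lemma integrableOn_tubeKernel {r : ℝ} (hr : 0 < r) (c : Fin d → ℝ) {x₀ x y : Fin (d + 2) → ℝ}
    {D : ℝ} (hD : ∀ uv ∈ xCell ε r c x₀ ×ˢ yCell ε r c, ‖tubeKernel ν x y uv‖ ≤ D) :
    IntegrableOn (tubeKernel ν x y) (xCell ε r c x₀ ×ˢ yCell ε r c) :=
  IntegrableOn.of_bound (volume_cell_lt_top hr ε c x₀)
    (measurable_tubeKernel ν x y).aestronglyMeasurable D
    ((ae_restrict_iff' ((measurableSet_xCell ε r c x₀).prod (measurableSet_yCell ε r c))).2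
      (Eventually.of_forall hD))

lemma IsKernelScale.le_norm_integral (hs : IsKernelScale d ν ε κ κ') {r : ℝ} (hr : 0 < r)
    (hr1 : r ≤ 1) {c : Fin d → ℝ} (hc : ∀ i, |c i| ≤ 1) {x₀ x y : Fin (d + 2) → ℝ}
    (hx : x ∈ xCell ε r c x₀) (hy : y ∈ Metric.ball (eVec (d + 2)) ε) :
    κ / 2 * volume.real (Metric.ball (0 : Fin (d + 2) → ℝ) ε) ^ 2 ≤
      ‖∫ uv in xCell ε r c x₀ ×ˢ yCell ε r c, tubeKernel ν x y uv‖ := by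
  have hb := fun uv huv => hs.tubeKernel_bounds hr hr1 hc hx hy (uv := uv) huv
  have hint := integrableOn_tubeKernel hr c fun uv huv => (hb uv huv).2
  refine le_trans ?_ (Complex.re_le_norm _)
  have hre : (∫ uv in xCell ε r c x₀ ×ˢ yCell ε r c, tubeKernel ν x y uv).re =
      ∫ uv in xCell ε r c x₀ ×ˢ yCell ε r c, (tubeKernel ν x y uv).re :=
    (integral_re hint).symm
  rw [hre]
  have := setIntegral_ge_of_const_le_real
    ((measurableSet_xCell ε r c x₀).prod (measurableSet_yCell ε r c))
    (volume_cell_lt_top hr ε c x₀).ne (fun uv huv => (hb uv huv).1) hint.re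
  rw [volume_real_cell hr] at this
  refine le_trans (le_of_eq ?_) this
  have : r ^ (d + 2) * r ^ (d + 2) ≠ 0 := by positivity
  field_simp

/-- Away from its diagonal the Bergman kernel has arbitrarily small integrals over cells. -/
lemma IsKernelScale.exists_norm_integral_le (hs : IsKernelScale d ν ε κ κ') (hν : 0 < ν) {r : ℝ}
    (hr : 0 < r) (c : Fin d → ℝ) {η : ℝ} (hη : 0 < η) :
    ∃ L, ∀ x₀ x y : Fin (d + 2) → ℝ,
      (∀ uv ∈ xCell ε r c x₀ ×ˢ yCell ε r c, L ≤ ‖tubeQ (x - uv.1) (y + uv.2)‖) →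
      IntegrableOn (tubeKernel ν x y) (xCell ε r c x₀ ×ˢ yCell ε r c) ∧
        ‖∫ uv in xCell ε r c x₀ ×ˢ yCell ε r c, tubeKernel ν x y uv‖ ≤ η := by
  set s := ν + ((d + 2 : ℕ) : ℝ) / 2 with hsdef
  set β := ν - ((d + 2 : ℕ) : ℝ) / 2 with hβ
  have hspos : 0 < s := by positivity
  set D := r ^ (-(2 * β)) * 2 * ((r ^ (d + 2) * r ^ (d + 2))⁻¹ *
        volume.real (Metric.ball (0 : Fin (d + 2) → ℝ) ε) ^ 2) with hD
  have hlim : Tendsto (fun L : ℝ => L ^ (-s) * D) atTop (𝓝 (0 * D)) :=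
    (tendsto_rpow_neg_atTop hspos).mul_const D
  rw [zero_mul] at hlim
  obtain ⟨L, hL, hL0⟩ := ((hlim.eventually (eventually_le_nhds hη)).and
    (eventually_gt_atTop 0)).exists
  refine ⟨L, fun x₀ x y h => ?_⟩
  have hb : ∀ uv ∈ xCell ε r c x₀ ×ˢ yCell ε r c,
      ‖tubeKernel ν x y uv‖ ≤ L ^ (-s) * (r ^ (-(2 * β)) * 2) := by
    intro uv huv
    have hQv : 0 ≤ lorentzQ (d + 2) uv.2 := (hs.yCell_subset hr c huv.2).2.le
    rw [tubeKernel, norm_mul, ← hsdef, Complex.norm_cpow_real, ← hβ, Complex.norm_real,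
      Real.norm_eq_abs, abs_of_nonneg (by positivity), lorentzQ_rpow_nullSim hr c _ hQv]
    refine mul_le_mul (Real.rpow_le_rpow_of_nonpos hL0 (h uv huv) (by linarith)) ?_
      ?_ (by positivity)
    · gcongr
      exact hs.rpow_le_two _ huv.2
    · have := hs.half_le_rpow _ huv.2
      rw [← hβ] at this
      positivity
  refine ⟨integrableOn_tubeKernel hr c hb, ?_⟩
  refine (norm_setIntegral_le_of_norm_le_const (volume_cell_lt_top hr ε c x₀) hb).trans ?_
  rw [volume_real_cell hr]
  refine le_trans (le_of_eq ?_) hL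
  rw [hD]; ring

end Cells

lemma IsKernelScale.exists_centers {ν ε κ κ' : ℝ} (hs : IsKernelScale d ν ε κ κ') (hν : 0 < ν)
    {J : Type*} [Fintype J] {r : J → ℝ} (hr : ∀ j, 0 < r j) (hr1 : ∀ j, r j ≤ 1)
    {c : J → Fin d → ℝ} (hc : ∀ j i, |c j i| ≤ 1) {γ : J → ℝ} (hγ : ∀ j, 0 < γ j) :
    ∃ x₀ : J → Fin (d + 2) → ℝ,
      (∀ i j, ∀ x, x ∈ xCell ε (r i) (c i) (x₀ i) → x ∈ xCell ε (r j) (c j) (x₀ j) → i = j) ∧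
      ∀ j, ∀ x ∈ xCell ε (r j) (c j) (x₀ j), ∀ y ∈ Metric.ball (eVec (d + 2)) ε,
        γ j * (κ / 4 * volume.real (Metric.ball (0 : Fin (d + 2) → ℝ) ε) ^ 2) ≤
          ‖bergmanOp (d + 2) ν (tubeStep γ (fun j => xCell ε (r j) (c j) (x₀ j))
            (fun j => yCell ε (r j) (c j))) (tubePt (d + 2) x y)‖ := by
  classical
  set b := volume.real (Metric.ball (0 : Fin (d + 2) → ℝ) ε) with hb
  have hbpos : 0 < b := ENNReal.toReal_pos (Metric.measure_ball_pos volume _ hs.pos).ne' measure_ball_lt_top.ne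
  have hκ := hs.kappa_pos
  obtain ⟨g, hg, hgle⟩ : ∃ g > 0, ∀ j, g ≤ γ j := by
    rcases isEmpty_or_nonempty J with h | h
    · exact ⟨1, one_pos, fun j => h.elim j⟩
    · obtain ⟨j, hj⟩ := Finite.exists_min γ
      exact ⟨γ j, hγ j, hj⟩
  have hΓ : 0 ≤ ∑ j, γ j := Finset.sum_nonneg fun j _ => (hγ j).le
  set η := g * (κ / 4 * b ^ 2) / (∑ j, γ j + 1) with hη
  have hηpos : 0 < η := by positivity
  choose L hL using fun j => hs.exists_norm_integral_le hν (hr j) (c j) hηpos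
  choose ρ hρ using fun j => exists_norm_le_of_nullSim (hr j) (c j) 2
  set R := ∑ j, |ρ j| with hR
  have hR0 : 0 ≤ R := Finset.sum_nonneg fun j _ => abs_nonneg _
  have hρR : ∀ j, ρ j ≤ R := fun j => (le_abs_self _).trans
    (Finset.single_le_sum (f := fun j => |ρ j|) (fun j _ => abs_nonneg _) (Finset.mem_univ j))
  have hLL : ∀ j, L j ≤ ∑ j, |L j| := fun j => (le_abs_self _).trans
    (Finset.single_le_sum (f := fun j => |L j|) (fun j _ => abs_nonneg _) (Finset.mem_univ j))
  obtain ⟨T, hT, hfar⟩ := le_norm_tubeQ_add_smul_eVec (d := d) (2 * R + 2) (∑ j, |L j|)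
  set M := T + 2 * R + 1 with hM
  let τ : J → ℝ := fun j => ((Fintype.equivFin J j : ℕ) : ℝ)
  have hτ : ∀ i j, i ≠ j → M ≤ |M * τ j - M * τ i| := by
    intro i j hij
    have hne : ((Fintype.equivFin J j : ℕ) : ℤ) - ((Fintype.equivFin J i : ℕ) : ℤ) ≠ 0 := by
      intro h
      apply hij
      apply (Fintype.equivFin J).injective
      apply Fin.ext
      omega
    have h1 : (1 : ℝ) ≤ |τ j - τ i| := by
      have := Int.one_le_abs hne
      simp only [τ]
      exact_mod_cast this
    rw [← mul_sub, abs_mul, abs_of_pos (by positivity : 0 < M)]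
    nlinarith [(by positivity : 0 < M)]
  have hcell : ∀ j x₀ x, x ∈ xCell ε (r j) (c j) x₀ → ‖x - x₀‖ ≤ R := by
    intro j x₀ x hx
    refine (hρ j _ ?_).trans (hρR j)
    have : ‖nullSim (r j) (c j) (x - x₀)‖ < ε := by simpa [xCell] using hx
    linarith [hs.le_eighth]
  refine ⟨fun j => (M * τ j) • eVec (d + 2), ?_, ?_⟩
  · intro i j x hi hj
    by_contra hij
    have h1 := norm_sub_le (x - (M * τ i) • eVec (d + 2)) (x - (M * τ j) • eVec (d + 2))
    have h2 := norm_le_pi_norm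
      (x - (M * τ i) • eVec (d + 2) - (x - (M * τ j) • eVec (d + 2))) 0
    have h3 : (x - (M * τ i) • eVec (d + 2) - (x - (M * τ j) • eVec (d + 2))) 0 =
        M * τ j - M * τ i := by
      simp [eVec]
    rw [h3, Real.norm_eq_abs] at h2
    linarith [hcell i _ x hi, hcell j _ x hj, hτ i j hij]
  · intro j x hx y hy
    have hoff : ∀ i, i ≠ j →
        IntegrableOn (tubeKernel ν x y)
          (xCell ε (r i) (c i) ((M * τ i) • eVec (d + 2)) ×ˢ yCell ε (r i) (c i)) ∧
        ‖∫ uv in xCell ε (r i) (c i) ((M * τ i) • eVec (d + 2)) ×ˢ yCell ε (r i) (c i),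
          tubeKernel ν x y uv‖ ≤ η := by
      intro i hij
      refine hL i _ x y fun uv huv => (hLL i).trans ?_
      have hsplit : x - uv.1 = ((x - (M * τ j) • eVec (d + 2)) -
          (uv.1 - (M * τ i) • eVec (d + 2))) + (M * τ j - M * τ i) • eVec (d + 2) := by
        rw [sub_smul]; abel
      rw [hsplit]
      have hv : ‖uv.2‖ ≤ R :=
        (hρ i _ (norm_le_two_of_mem_ball_eVec hs.le_eighth huv.2)).trans (hρR i)
      refine hfar _ _ _ ?_ ?_ ?_ ?_
      · refine (norm_sub_le _ _).trans ?_
        linarith [hcell j _ x hx, hcell i _ _ huv.1]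
      · refine (norm_add_le _ _).trans ?_
        linarith [norm_le_two_of_mem_ball_eVec hs.le_eighth hy]
      · have h1 := (abs_lt.1 (abs_sub_lt_of_mem_ball_eVec hs.le_eighth hy).1).1
        have h2 := (hs.yCell_subset (hr i) (c i) huv.2).1
        rw [Pi.add_apply]
        linarith
      · exact le_trans (by linarith) (hτ i j hij)
    have hdiag := hs.le_norm_integral (hr j) (hr1 j) (hc j) hx hy
    have hdiagint := integrableOn_tubeKernel (hr j) (c j) (ν := ν)
      fun uv huv => (hs.tubeKernel_bounds (hr j) (hr1 j) (hc j) hx hy (uv := uv) huv).2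
    have hop := bergmanOp_tubeStep ν γ
      (U := fun j => xCell ε (r j) (c j) ((M * τ j) • eVec (d + 2)))
      (V := fun j => yCell ε (r j) (c j)) (fun j => measurableSet_xCell _ _ _ _)
      (fun j => measurableSet_yCell _ _ _) (fun j => hs.yCell_subset (hr j) (c j)) x y
      (fun i => by
        by_cases hij : i = j
        · subst hij; exact hdiagint
        · exact (hoff i hij).1)
    rw [hop, ← Finset.add_sum_erase _ _ (Finset.mem_univ j)]
    refine le_trans ?_ (norm_sub_le_norm_add _ _)
    have hmain : γ j * (κ / 2 * b ^ 2) ≤ ‖(γ j : ℂ) *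
        ∫ uv in xCell ε (r j) (c j) ((M * τ j) • eVec (d + 2)) ×ˢ yCell ε (r j) (c j),
          tubeKernel ν x y uv‖ := by
      rw [norm_mul, Complex.norm_of_nonneg (hγ j).le]
      exact mul_le_mul_of_nonneg_left hdiag (hγ j).le
    have herr : ‖∑ i ∈ Finset.univ.erase j, (γ i : ℂ) *
        ∫ uv in xCell ε (r i) (c i) ((M * τ i) • eVec (d + 2)) ×ˢ yCell ε (r i) (c i),
          tubeKernel ν x y uv‖ ≤ γ j * (κ / 4 * b ^ 2) := by
      have h1 : ∀ i ∈ Finset.univ.erase j, ‖(γ i : ℂ) *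
          ∫ uv in xCell ε (r i) (c i) ((M * τ i) • eVec (d + 2)) ×ˢ yCell ε (r i) (c i),
            tubeKernel ν x y uv‖ ≤ γ i * η := by
        intro i hi
        rw [norm_mul, Complex.norm_of_nonneg (hγ i).le]
        exact mul_le_mul_of_nonneg_left (hoff i (Finset.ne_of_mem_erase hi)).2 (hγ i).le
      refine (norm_sum_le_of_le _ h1).trans ?_
      rw [← Finset.sum_mul]
      have h2 : ∑ i ∈ Finset.univ.erase j, γ i ≤ ∑ i, γ i + 1 := by
        have := Finset.sum_le_univ_sum_of_nonneg (s := Finset.univ.erase j) fun i => (hγ i).le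
        linarith
      calc (∑ i ∈ Finset.univ.erase j, γ i) * η ≤ (∑ i, γ i + 1) * η := by gcongr
        _ = g * (κ / 4 * b ^ 2) := by rw [hη]; field_simp
        _ ≤ γ j * (κ / 4 * b ^ 2) := by gcongr; exact hgle j
    refine le_trans ?_ (sub_le_sub hmain herr)
    linarith

/-- The indices of the counterexample: scales `2 ^ k` with `k < K`, and at each scale a grid of
null directions. -/
abbrev ScaleIndex (d K : ℕ) : Type := Σ k : Fin K, Fin d → Fin (2 ^ (k : ℕ))

/-- The dilation factor of an index. -/
def scaleRatio {K : ℕ} (j : ScaleIndex d K) : ℝ := ((2 : ℝ) ^ (j.1 : ℕ))⁻¹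

/-- The null direction of an index. -/
def scaleCenter {K : ℕ} (j : ScaleIndex d K) (i : Fin d) : ℝ :=
  ((j.2 i : ℕ) : ℝ) * scaleRatio j

lemma scaleRatio_pos {K : ℕ} (j : ScaleIndex d K) : 0 < scaleRatio j := by
  unfold scaleRatio; positivity

lemma scaleRatio_le_one {K : ℕ} (j : ScaleIndex d K) : scaleRatio j ≤ 1 :=
  inv_le_one_of_one_le₀ (one_le_pow₀ one_le_two)

lemma abs_scaleCenter_le_one {K : ℕ} (j : ScaleIndex d K) (i : Fin d) :
    |scaleCenter j i| ≤ 1 := by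
  have h : ((j.2 i : ℕ) : ℝ) ≤ (2 : ℝ) ^ (j.1 : ℕ) := by exact_mod_cast (j.2 i).2.le
  have hp : (0 : ℝ) < (2 : ℝ) ^ (j.1 : ℕ) := by positivity
  unfold scaleCenter scaleRatio
  rw [abs_of_nonneg (by positivity), ← div_eq_mul_inv, div_le_one hp]
  exact h

lemma abs_sq_mul_sub_one_lt_of_mem_yCell {ε r : ℝ} (hε : ε ≤ 1 / 8) {c : Fin d → ℝ}
    {v : Fin (d + 2) → ℝ} (hv : v ∈ yCell ε r c) : |r ^ 2 * (v 0 + v 1) - 1| < 1 / 4 := by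
  obtain ⟨h0, h1, -⟩ := abs_sub_lt_of_mem_ball_eVec hε hv
  rw [← nullSim_zero_add_one r c v]
  rw [abs_lt] at h0 h1 ⊢
  constructor <;> linarith

lemma scale_le_of_mem_yCell {ε : ℝ} (hε : ε ≤ 1 / 8) {k l : ℕ} {c c' : Fin d → ℝ}
    {v : Fin (d + 2) → ℝ} (hk : v ∈ yCell ε ((2 : ℝ) ^ k)⁻¹ c)
    (hl : v ∈ yCell ε ((2 : ℝ) ^ l)⁻¹ c') : k ≤ l := by
  by_contra! hlt
  obtain ⟨m, rfl⟩ := Nat.exists_eq_add_of_lt hlt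
  have h1 := (abs_lt.1 (abs_sq_mul_sub_one_lt_of_mem_yCell hε hk)).1
  have h2 := (abs_lt.1 (abs_sq_mul_sub_one_lt_of_mem_yCell hε hl)).2
  set t := (((2 : ℝ) ^ l)⁻¹) ^ 2 * (v 0 + v 1)
  have h3 : (((2 : ℝ) ^ (l + m + 1))⁻¹) ^ 2 * (v 0 + v 1) =
      ((((2 : ℝ) ^ m)⁻¹) ^ 2 / 4) * t := by
    simp only [t, pow_succ, pow_add, mul_inv]; ring
  rw [h3] at h1
  have h4 : (((2 : ℝ) ^ m)⁻¹) ^ 2 ≤ 1 :=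
    pow_le_one₀ (by positivity) (inv_le_one_of_one_le₀ (one_le_pow₀ one_le_two))
  have h5 : 0 ≤ (((2 : ℝ) ^ m)⁻¹) ^ 2 := by positivity
  nlinarith

lemma eq_of_mem_yCell {ε : ℝ} (hε : ε ≤ 1 / 8) {K : ℕ} (i j : ScaleIndex d K)
    (v : Fin (d + 2) → ℝ) (hi : v ∈ yCell ε (scaleRatio i) (scaleCenter i))
    (hj : v ∈ yCell ε (scaleRatio j) (scaleCenter j)) : i = j := by
  obtain ⟨k, m⟩ := i
  obtain ⟨l, m'⟩ := j
  obtain rfl : k = l :=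
    Fin.ext (le_antisymm (scale_le_of_mem_yCell hε hi hj) (scale_le_of_mem_yCell hε hj hi))
  congr 1
  funext a
  apply Fin.ext
  have hs := (abs_lt.1 (abs_sq_mul_sub_one_lt_of_mem_yCell hε hi)).1
  have h1 := (abs_sub_lt_of_mem_ball_eVec hε hi).2.2 a
  have h2 := (abs_sub_lt_of_mem_ball_eVec hε hj).2.2 a
  rw [nullSim_succ_succ] at h1 h2
  by_contra hne
  have hone : (1 : ℝ) ≤ |((m a : ℕ) : ℝ) - ((m' a : ℕ) : ℝ)| := by
    have : ((m a : ℕ) : ℤ) - ((m' a : ℕ) : ℤ) ≠ 0 := by omega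
    exact_mod_cast Int.one_le_abs this
  have hr : scaleRatio (⟨k, m'⟩ : ScaleIndex d K) = scaleRatio (⟨k, m⟩ : ScaleIndex d K) := rfl
  simp only [scaleCenter, hr] at h1 h2
  set r := scaleRatio (⟨k, m⟩ : ScaleIndex d K)
  have h3 : |r ^ 2 * (v 0 + v 1) * (((m a : ℕ) : ℝ) - ((m' a : ℕ) : ℝ))| < 1 / 4 := by
    rw [abs_lt] at h1 h2 ⊢
    constructor <;> linarith
  rw [abs_mul, abs_of_pos (by linarith)] at h3
  nlinarith

lemma sum_scaleRatio_pow (d K : ℕ) : ∑ j : ScaleIndex d K, scaleRatio j ^ d = K := by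
  rw [Fintype.sum_sigma]
  have : ∀ k : Fin K, ∑ m : Fin d → Fin (2 ^ (k : ℕ)),
      scaleRatio (⟨k, m⟩ : ScaleIndex d K) ^ d = 1 := by
    intro k
    simp only [scaleRatio, Finset.sum_const, Finset.card_univ, Fintype.card_fun, Fintype.card_fin,
      nsmul_eq_mul, inv_pow]
    push_cast
    exact mul_inv_cancel₀ (by positivity)
  simp [this]

lemma IsKernelScale.lintegral_yCell_le {ν ε κ κ' : ℝ} (hs : IsKernelScale d ν ε κ κ') {r : ℝ}
    (hr : 0 < r) (c : Fin d → ℝ) :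
    ∫⁻ y in yCell ε r c, ENNReal.ofReal (lorentzQ (d + 2) y ^ (ν - ((d + 2 : ℕ) : ℝ) / 2)) ≤
      ENNReal.ofReal
        (2 * volume.real (Metric.ball (0 : Fin (d + 2) → ℝ) ε) * r ^ (-(2 * ν))) := by
  have hle : ∀ y ∈ yCell ε r c,
      ENNReal.ofReal (lorentzQ (d + 2) y ^ (ν - ((d + 2 : ℕ) : ℝ) / 2)) ≤
        ENNReal.ofReal (r ^ (-(2 * (ν - ((d + 2 : ℕ) : ℝ) / 2))) * 2) := by
    intro y hy
    rw [lorentzQ_rpow_nullSim hr c y (hs.yCell_subset hr c hy).2.le]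
    gcongr
    exact hs.rpow_le_two _ hy
  refine (setLIntegral_mono' (measurableSet_yCell ε r c) hle).trans ?_
  rw [setLIntegral_const, volume_yCell hr]
  rw [← ENNReal.ofReal_toReal (measure_ball_lt_top (μ := volume) (x := (0 : Fin (d + 2) → ℝ))
    (r := ε)).ne, ← ENNReal.ofReal_mul (by positivity), ← ENNReal.ofReal_mul (by positivity),
    measureReal_def]
  apply le_of_eq
  congr 1
  have : r ^ (-(2 * ν)) = r ^ (-(2 * (ν - ((d + 2 : ℕ) : ℝ) / 2))) * (r ^ (d + 2))⁻¹ := by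
    rw [← Real.rpow_natCast, ← Real.rpow_neg hr.le, ← Real.rpow_add hr]
    congr 1; ring
  rw [this]; ring

lemma measurable_weight (n : ℕ) [NeZero n] (t : ℝ) :
    Measurable fun y : Fin n → ℝ => ENNReal.ofReal (lorentzQ n y ^ t) :=
  ((continuous_lorentzQ n).measurable.pow_const t).ennreal_ofReal

lemma IsKernelScale.mixedNorm_tubeStep_lt_top {ν ε κ κ' : ℝ} (hs : IsKernelScale d ν ε κ κ')
    {p q : ℝ} (hp : 0 < p) (hq : 0 < q) {K : ℕ} {γ : ScaleIndex d K → ℝ} (hγ : ∀ j, 0 ≤ γ j)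
    (x₀ : ScaleIndex d K → Fin (d + 2) → ℝ) :
    mixedNorm (d + 2) p q ν
      (tubeStep γ (fun j => xCell ε (scaleRatio j) (scaleCenter j) (x₀ j))
        (fun j => yCell ε (scaleRatio j) (scaleCenter j))) < ∞ := by
  refine ENNReal.rpow_lt_top_of_nonneg (by positivity) (ne_top_of_le_ne_top ?_
    (lintegral_tubeStep_le hp hq hγ (fun j => measurableSet_xCell _ _ _ _)
      (fun j => measurableSet_yCell _ _ _) (eq_of_mem_yCell hs.le_eighth)
      (measurable_weight _ _) _))
  refine (ENNReal.sum_lt_top.2 fun j _ => ENNReal.mul_lt_top ?_ ?_).ne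
  · refine ENNReal.rpow_lt_top_of_nonneg (by positivity) (ENNReal.mul_lt_top
      (ENNReal.rpow_lt_top_of_nonneg hp.le ENNReal.ofReal_ne_top) ?_).ne
    rw [volume_xCell (scaleRatio_pos j)]
    exact ENNReal.mul_lt_top ENNReal.ofReal_lt_top measure_ball_lt_top
  · exact (hs.lintegral_yCell_le (scaleRatio_pos j) _).trans_lt ENNReal.ofReal_lt_top

lemma ofReal_rpow_mul_volume_xCell {p r a : ℝ} (hp : 0 < p) (hr : 0 < r) (ha : 0 ≤ a) (ε : ℝ)
    (c : Fin d → ℝ) (x₀ : Fin (d + 2) → ℝ) :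
    ENNReal.ofReal (r ^ ((2 * d + 2 : ℝ) / p) * a) ^ p * volume (xCell ε r c x₀) =
      ENNReal.ofReal (r ^ d *
        (a ^ p * volume.real (Metric.ball (0 : Fin (d + 2) → ℝ) ε))) := by
  rw [volume_xCell hr, ← ENNReal.ofReal_toReal (measure_ball_lt_top (μ := volume)
    (x := (0 : Fin (d + 2) → ℝ)) (r := ε)).ne, ENNReal.ofReal_rpow_of_nonneg (by positivity) hp.le,
    ← ENNReal.ofReal_mul (by positivity), ← ENNReal.ofReal_mul (by positivity), measureReal_def,
    Real.mul_rpow (by positivity) ha, ← Real.rpow_mul hr.le, div_mul_cancel₀ _ hp.ne']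
  congr 1
  have : r ^ (2 * d + 2 : ℝ) = r ^ d * r ^ (d + 2) := by
    rw [← pow_add, ← Real.rpow_natCast]
    congr 1; push_cast; ring
  rw [this]; field_simp

/-- A bound for the Bergman projection forces a power of the number of scales to be dominated
by that number. -/
lemma IsKernelScale.scale_inequality {ν ε κ κ' : ℝ} (hs : IsKernelScale d ν ε κ κ') (hν : 0 < ν)
    {p q C : ℝ} (hp : 0 < p) (hq : 0 < q) (hC : 0 < C) (hdq : 2 * ν + d ≤ d * (q / p))
    (hbound : ∀ F : (Fin (d + 2) → ℂ) → ℂ, Measurable F →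
      mixedNorm (d + 2) 2 2 ν F < ∞ → mixedNorm (d + 2) p q ν F < ∞ →
        mixedNorm (d + 2) p q ν (bergmanOp (d + 2) ν F) ≤
          ENNReal.ofReal C * mixedNorm (d + 2) p q ν F) :
    ∃ A > 0, ∃ B > 0, ∀ K : ℕ, (K * A : ℝ) ^ (q / p) ≤ B * K := by
  set b := volume.real (Metric.ball (0 : Fin (d + 2) → ℝ) ε) with hb
  have hbpos : 0 < b := ENNReal.toReal_pos (Metric.measure_ball_pos volume _ hs.pos).ne'
    measure_ball_lt_top.ne
  have hκ := hs.kappa_pos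
  refine ⟨(κ / 4 * b ^ 2) ^ p * b, by positivity,
    C ^ q * (b ^ (q / p) * (2 * b)) / (b / 2), by positivity, fun K => ?_⟩
  have hγ : ∀ j : ScaleIndex d K, 0 < scaleRatio j ^ ((2 * d + 2 : ℝ) / p) :=
    fun j => Real.rpow_pos_of_pos (scaleRatio_pos j) _
  obtain ⟨x₀, hU, hT⟩ := hs.exists_centers hν scaleRatio_pos scaleRatio_le_one
    abs_scaleCenter_le_one hγ
  set F := tubeStep (fun j : ScaleIndex d K => scaleRatio j ^ ((2 * d + 2 : ℝ) / p))
    (fun j => xCell ε (scaleRatio j) (scaleCenter j) (x₀ j))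
    (fun j => yCell ε (scaleRatio j) (scaleCenter j))
  have hmain := hbound F
    (measurable_tubeStep _ (fun j => measurableSet_xCell _ _ _ _)
      (fun j => measurableSet_yCell _ _ _))
    (hs.mixedNorm_tubeStep_lt_top two_pos two_pos (fun j => (hγ j).le) x₀)
    (hs.mixedNorm_tubeStep_lt_top hp hq (fun j => (hγ j).le) x₀)
  have hlow := le_lintegral_of_le_norm hp hq
    (fun j => measurableSet_xCell ε (scaleRatio j) (scaleCenter j) (x₀ j)) hU
    (measurable_weight (d + 2) (ν - ((d + 2 : ℕ) : ℝ) / 2)) measurableSet_ball hs.ball_subset hT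
  have hup := lintegral_tubeStep_le hp hq (fun j => (hγ j).le)
    (fun j => measurableSet_xCell ε (scaleRatio j) (scaleCenter j) (x₀ j))
    (fun j => measurableSet_yCell ε (scaleRatio j) (scaleCenter j))
    (eq_of_mem_yCell hs.le_eighth)
    (measurable_weight (d + 2) (ν - ((d + 2 : ℕ) : ℝ) / 2)) (lightCone (d + 2))
  have hpow := ENNReal.rpow_le_rpow hmain hq.le
  unfold mixedNorm at hpow
  rw [ENNReal.mul_rpow_of_nonneg _ _ hq.le, ← ENNReal.rpow_mul, ← ENNReal.rpow_mul,
    one_div_mul_cancel hq.ne', ENNReal.rpow_one, ENNReal.rpow_one] at hpow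
  have hlow' : ENNReal.ofReal ((K * ((κ / 4 * b ^ 2) ^ p * b)) ^ (q / p) * (b / 2)) ≤
      (∑ j : ScaleIndex d K,
        ENNReal.ofReal (scaleRatio j ^ ((2 * d + 2 : ℝ) / p) * (κ / 4 * b ^ 2)) ^ p *
          volume (xCell ε (scaleRatio j) (scaleCenter j) (x₀ j))) ^ (q / p) *
      ∫⁻ y in Metric.ball (eVec (d + 2)) ε,
        ENNReal.ofReal (lorentzQ (d + 2) y ^ (ν - ((d + 2 : ℕ) : ℝ) / 2)) := by
    rw [ENNReal.ofReal_mul (by positivity), ← ENNReal.ofReal_rpow_of_nonneg (by positivity)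
      (by positivity)]
    gcongr
    · apply le_of_eq
      rw [Finset.sum_congr rfl fun j _ => ofReal_rpow_mul_volume_xCell hp (scaleRatio_pos j)
        (by positivity) ε (scaleCenter j) (x₀ j), ← ENNReal.ofReal_sum_of_nonneg
        (fun j _ => mul_nonneg (pow_nonneg (scaleRatio_pos j).le _) (by positivity)),
        ← Finset.sum_mul, sum_scaleRatio_pow]
    · refine le_trans ?_ (setLIntegral_mono' measurableSet_ball fun y hy =>
        ENNReal.ofReal_le_ofReal (hs.half_le_rpow y hy))
      rw [setLIntegral_const, Measure.addHaar_ball_center, ← ENNReal.ofReal_toReal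
        (measure_ball_lt_top (μ := volume) (x := (0 : Fin (d + 2) → ℝ)) (r := ε)).ne,
        ← ENNReal.ofReal_mul (by norm_num), ← measureReal_def, ← hb]
      apply le_of_eq
      congr 1; ring
  have hup' : ∑ j : ScaleIndex d K,
      (ENNReal.ofReal (scaleRatio j ^ ((2 * d + 2 : ℝ) / p)) ^ p *
        volume (xCell ε (scaleRatio j) (scaleCenter j) (x₀ j))) ^ (q / p) *
      ∫⁻ y in yCell ε (scaleRatio j) (scaleCenter j),
        ENNReal.ofReal (lorentzQ (d + 2) y ^ (ν - ((d + 2 : ℕ) : ℝ) / 2)) ≤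
      ENNReal.ofReal (K * (b ^ (q / p) * (2 * b))) := by
    rw [← sum_scaleRatio_pow d K, Finset.sum_mul, ENNReal.ofReal_sum_of_nonneg
      (fun j _ => mul_nonneg (pow_nonneg (scaleRatio_pos j).le _) (by positivity))]
    refine Finset.sum_le_sum fun j _ => ?_
    have hr := scaleRatio_pos j
    have hvol := ofReal_rpow_mul_volume_xCell hp hr zero_le_one ε (scaleCenter j) (x₀ j)
    rw [mul_one, Real.one_rpow, one_mul, ← hb] at hvol
    rw [hvol]
    refine (mul_le_mul_right (hs.lintegral_yCell_le hr (scaleCenter j)) _).trans ?_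
    rw [ENNReal.ofReal_rpow_of_nonneg (by positivity) (by positivity),
      ← ENNReal.ofReal_mul (by positivity), ← hb]
    refine ENNReal.ofReal_le_ofReal ?_
    have hexp : (scaleRatio j ^ d) ^ (q / p) * scaleRatio j ^ (-(2 * ν)) ≤ scaleRatio j ^ d := by
      rw [← Real.rpow_natCast, ← Real.rpow_mul hr.le, ← Real.rpow_add hr]
      exact Real.rpow_le_rpow_of_exponent_ge hr (scaleRatio_le_one j) (by linarith)
    rw [Real.mul_rpow (by positivity) hbpos.le]
    calc (scaleRatio j ^ d) ^ (q / p) * b ^ (q / p) * (2 * b * scaleRatio j ^ (-(2 * ν)))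
        = ((scaleRatio j ^ d) ^ (q / p) * scaleRatio j ^ (-(2 * ν))) *
          (b ^ (q / p) * (2 * b)) := by ring
      _ ≤ _ := by gcongr
  have hall := hlow'.trans (hlow.trans (hpow.trans (mul_le_mul_right (hup.trans hup') _)))
  rw [ENNReal.ofReal_rpow_of_nonneg hC.le hq.le, ← ENNReal.ofReal_mul (by positivity),
    ENNReal.ofReal_le_ofReal_iff (by positivity)] at hall
  rw [div_mul_eq_mul_div _ (b / 2) (K : ℝ), le_div_iff₀ (by positivity)]
  linarith

lemma not_forall_natCast_rpow_le {s A B : ℝ} (hs : 1 < s) (hA : 0 < A) :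
    ¬ ∀ K : ℕ, (K * A : ℝ) ^ s ≤ B * K := by
  intro h
  have h1 : Tendsto (fun K : ℕ => ((K : ℝ)) ^ (s - 1)) atTop atTop :=
    (tendsto_rpow_atTop (by linarith)).comp tendsto_natCast_atTop_atTop
  obtain ⟨K, hK, hK0⟩ := ((h1.eventually_gt_atTop (B / A ^ s)).and
    (eventually_gt_atTop 0)).exists
  have hK0' : (0 : ℝ) < K := by exact_mod_cast hK0
  have h2 := h K
  rw [Real.mul_rpow hK0'.le hA.le] at h2
  rw [div_lt_iff₀ (by positivity), Real.rpow_sub_one hK0'.ne', div_mul_eq_mul_div,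
    lt_div_iff₀ hK0'] at hK
  linarith

/-- For `n ≥ 3`, `ν > n/2 − 1`, `1 ≤ p ≤ 2` and `q_{ν,p} ≤ q < ∞`, the
weighted Bergman projection admits no bounded extension to `L^{p,q}_ν`: there is no
constant `C > 0` with `‖T_ν F‖_{L^{p,q}_ν} ≤ C ‖F‖_{L^{p,q}_ν}` for all `F ∈ L²_ν`
with finite mixed norm. -/
theorem statement1 (n : ℕ) [NeZero n] (hn : 3 ≤ n) (ν p q : ℝ)
    (hν : (n : ℝ) / 2 - 1 < ν) (hp1 : 1 ≤ p) (hp2 : p ≤ 2)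
    (hq : pSharp p * qnu n ν ≤ q) :
    ¬ ∃ C : ℝ, 0 < C ∧
        ∀ F : (Fin n → ℂ) → ℂ, Measurable F →
          mixedNorm n 2 2 ν F < ∞ → mixedNorm n p q ν F < ∞ →
          mixedNorm n p q ν (bergmanOp n ν F) ≤ ENNReal.ofReal C * mixedNorm n p q ν F := by
  rintro ⟨C, hC, hbound⟩
  obtain ⟨d, rfl⟩ : ∃ d, n = d + 2 := ⟨n - 2, by omega⟩
  have hd : (1 : ℝ) ≤ d := by exact_mod_cast (by omega : 1 ≤ d)
  have hn2 : ((d + 2 : ℕ) : ℝ) / 2 - 1 = d / 2 := by push_cast; ring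
  rw [hn2] at hν
  have hp0 : 0 < p := by linarith
  have hν0 : 0 < ν := by linarith
  rw [pSharp, if_pos hp2, qnu, add_sub_assoc, hn2, ← le_div_iff₀' hp0,
    div_le_iff₀ (by linarith)] at hq
  have hdq : 2 * ν + d ≤ d * (q / p) := by linarith
  have hqp : 1 < q / p := by nlinarith
  have hq0 : 0 < q := by
    have := (lt_div_iff₀ hp0).1 hqp
    linarith
  obtain ⟨ε, κ, κ', hs⟩ := exists_isKernelScale d hν0
  obtain ⟨A, hA, B, -, hAB⟩ := hs.scale_inequality hν0 hp0 hq0 hC hdq hbound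
  exact not_forall_natCast_rpow_le hqp hA hAB
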